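/- The CHINS-style greedy insertion procedure, which starts from a single seed node and repeatedly connects the nearest not-yet-included terminal to the current partial tree via a shortest path, produces a tree spanning all κ terminals whose total cost W satisfies W/W_opt ≤ 2·(1 − 1/κ), where W_opt is the cost of an optimal Steiner tree for the terminals. In particular the greedy solution costs at most twice the optimum. -/

import Mathlib

/-- The total weight of a walk: sum of the weights of its edges. -/
noncomputable def walkWeight {V : Type*} {G : SimpleGraph V}
    (we : Sym2 V → NNReal) {u v : V} (p : G.Walk u v) : NNReal :=
  (p.edges.map we).sum

/-- Weighted shortest-path distance. -/
noncomputable def wdist {V : Type*} (G : SimpleGraph V) (we : Sym2 V → NNReal)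
    (u v : V) : NNReal :=
  sInf {x | ∃ p : G.Walk u v, x = walkWeight we p}

/-- Distance from a set of vertices to a vertex. -/
noncomputable def setDist {V : Type*} (G : SimpleGraph V) (we : Sym2 V → NNReal)
    (A : Set V) (v : V) : NNReal :=
  sInf {x | ∃ u ∈ A, x = wdist G we u v}

/-- Total edge cost of a subgraph. -/
noncomputable def subgraphCost {V : Type*} {G : SimpleGraph V}
    (we : Sym2 V → NNReal) (H : G.Subgraph) : NNReal :=
  ∑ᶠ e ∈ H.edgeSet, we e

/-- A Steiner tree for a set of terminals: a subtree of `G` containing all the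
terminals. -/
def IsSteinerTree {V : Type*} (G : SimpleGraph V) (terminals : Set V)
    (H : G.Subgraph) : Prop :=
  terminals ⊆ H.verts ∧ H.coe.IsTree

/-- One step of the CHINS greedy insertion: connect the terminal nearest to the
current partial tree `T` via a shortest path that leaves `T` immediately,
obtaining `T'`. -/
def ChinsStep {V : Type*} (G : SimpleGraph V) (we : Sym2 V → NNReal)
    (terminals : Set V) (T T' : G.Subgraph) : Prop :=
  ∃ x ∈ terminals, x ∉ T.verts ∧
    (∀ y ∈ terminals, y ∉ T.verts →
      setDist G we T.verts x ≤ setDist G we T.verts y) ∧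
    ∃ (u : V) (_ : u ∈ T.verts) (p : G.Walk u x), p.IsPath ∧
      walkWeight we p = setDist G we T.verts x ∧
      (∀ z ∈ p.support, z ≠ u → z ∉ T.verts) ∧
      T' = T ⊔ p.toSubgraph

/-- The total cost of the consecutive pairs of a list. -/
def chainCost {α : Type*} (D : α → α → NNReal) : List α → NNReal
  | a :: b :: l => D a b + chainCost D (b :: l)
  | _ => 0

section ChainCost

variable {α : Type*} {D : α → α → NNReal}

@[simp] lemma chainCost_singleton (a : α) : chainCost D [a] = 0 := by simp [chainCost]

@[simp] lemma chainCost_cons_cons (a b : α) (l : List α) :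
    chainCost D (a :: b :: l) = D a b + chainCost D (b :: l) := by simp [chainCost]

lemma chainCost_insert_detour (A B : List α) (a b : α) :
    chainCost D (A ++ a :: b :: a :: B) = chainCost D (A ++ a :: B) + (D a b + D b a) := by
  induction A with
  | nil => simp; ring
  | cons x A ih =>
    cases A with
    | nil => simp; ring
    | cons y A => simp only [List.cons_append, chainCost_cons_cons] at ih ⊢; rw [ih]; ring

lemma chainCost_map_le {β : Type*} {M : β → β → NNReal} (f : α → β) (l : List α)
    (h : ∀ a ∈ l, ∀ b ∈ l, M (f a) (f b) ≤ D a b) :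
    chainCost M (l.map f) ≤ chainCost D l := by
  induction l with
  | nil => simp [chainCost]
  | cons a l ih =>
    cases l with
    | nil => simp
    | cons b l =>
      simp only [List.map_cons, chainCost_cons_cons] at ih ⊢
      exact add_le_add (h a (by simp) b (by simp))
        (ih fun x hx y hy => h x (by simp [hx]) y (by simp [hy]))

lemma chainCost_cons_le (tri : ∀ x y z, D x z ≤ D x y + D y z) (a b c : α) (l : List α) :
    chainCost D (a :: l ++ [c]) ≤ D a b + chainCost D (b :: l ++ [c]) := by
  cases l with
  | nil => simpa using tri a b c
  | cons y l =>
    simp only [List.cons_append, chainCost_cons_cons, ← add_assoc]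
    gcongr
    exact tri a b y

lemma chainCost_filter_le (tri : ∀ x y z, D x z ≤ D x y + D y z) (P : α → Bool)
    (a c : α) (l : List α) :
    chainCost D (a :: l.filter P ++ [c]) ≤ chainCost D (a :: l ++ [c]) := by
  induction l generalizing a with
  | nil => simp
  | cons b l ih =>
    by_cases hb : P b
    · simpa [hb] using ih b
    · simp only [List.filter_cons, hb, Bool.false_eq_true, if_false]
      refine (ih a).trans ?_
      simpa using chainCost_cons_le tri a b c l

lemma dist_le_chainCost (tri : ∀ x y z, D x z ≤ D x y + D y z) (a c : α) (l : List α) :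
    D a c ≤ chainCost D (a :: l ++ [c]) := by
  simpa using chainCost_filter_le tri (fun _ => false) a c l

lemma dist_add_dist_le_chainCost (tri : ∀ x y z, D x z ≤ D x y + D y z) {x : α}
    (a c : α) (l : List α) (hx : x ∈ l) :
    D a x + D x c ≤ chainCost D (a :: l ++ [c]) := by
  induction l generalizing a with
  | nil => simp at hx
  | cons b l ih =>
    simp only [List.cons_append, chainCost_cons_cons]
    by_cases hb : x = b
    · subst hb
      gcongr
      exact dist_le_chainCost tri _ c l
    · have hl : x ∈ l := by simpa [hb] using hx
      calc D a x + D x c ≤ D a b + D b x + D x c := by gcongr; exact tri a b x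
        _ = D a b + (D b x + D x c) := add_assoc _ _ _
        _ ≤ _ := by gcongr; exact ih b hl

lemma tri_of_ultra (ultra : ∀ x y z, D x z ≤ max (D x y) (D y z)) (x y z : α) :
    D x z ≤ D x y + D y z :=
  (ultra x y z).trans (max_le_add_of_nonneg (zero_le) (zero_le))

end ChainCost

section Ultrametric

variable {α : Type*} [DecidableEq α] {M : α → α → NNReal}

lemma chainCost_filter_ne_add_le_cons (symm : ∀ x y, M x y = M y x)
    (ultra : ∀ x y z, M x z ≤ max (M x y) (M y z)) {x a c : α} {δ : NNReal} (l : List α)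
    (ha : δ ≤ M x a) (hc : δ ≤ M x c) (hl : ∀ y ∈ l, y ≠ x → δ ≤ M x y) :
    chainCost M (a :: l.filter (· ≠ x) ++ [c]) + δ ≤ M a x + chainCost M (x :: l ++ [c]) := by
  have key : ∀ b, δ ≤ M x b → M a b + δ ≤ M a x + M x b := fun b hb => by
    rw [symm] at ha
    rcases le_max_iff.1 (ultra a x b) with h | h
    · exact add_le_add h hb
    · rw [add_comm (M a x)]; exact add_le_add h ha
  induction l with
  | nil => simpa using key c hc
  | cons b l ih =>
    have ih := ih fun y hy => hl y (by simp [hy])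
    by_cases hb : b = x
    · subst hb
      simp only [List.cons_append, chainCost_cons_cons] at ih ⊢
      simpa [← add_assoc] using ih.trans (add_le_add_right (le_add_of_nonneg_left (zero_le)) _)
    · have h1 := chainCost_filter_le (tri_of_ultra ultra) (· ≠ x) b c l
      have h2 := key b (hl b (by simp) hb)
      simp only [List.filter_cons, hb, ne_eq, not_false_eq_true, decide_true, if_true,
        List.cons_append, chainCost_cons_cons] at h1 ⊢
      calc _ = (M a b + δ) + chainCost M (b :: (l.filter (fun y => decide ¬ y = x) ++ [c])) := by
            ring
        _ ≤ (M a x + M x b) + chainCost M (b :: (l ++ [c])) := add_le_add h2 h1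
        _ = _ := by ring

lemma chainCost_filter_ne_add_le (symm : ∀ x y, M x y = M y x)
    (ultra : ∀ x y z, M x z ≤ max (M x y) (M y z)) {x c : α} {δ : NNReal} (a : α) (l : List α)
    (hx : x ∈ l) (ha : δ ≤ M x a) (hc : δ ≤ M x c) (hl : ∀ y ∈ l, y ≠ x → δ ≤ M x y) :
    chainCost M (a :: l.filter (· ≠ x) ++ [c]) + δ ≤ chainCost M (a :: l ++ [c]) := by
  induction l generalizing a with
  | nil => simp at hx
  | cons b l ih =>
    have hl' : ∀ y ∈ l, y ≠ x → δ ≤ M x y := fun y hy => hl y (by simp [hy])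
    by_cases hb : b = x
    · subst hb
      simpa using chainCost_filter_ne_add_le_cons symm ultra l ha hc hl'
    · have := ih b (by simpa [Ne.symm hb] using hx) (hl b (by simp) hb) hl'
      simp only [List.filter_cons, hb, ne_eq, not_false_eq_true, decide_true, if_true,
        List.cons_append, chainCost_cons_cons] at this ⊢
      rw [add_assoc]
      gcongr

end Ultrametric

section Bottleneck

/-- The largest of the values `d i` over the cuts `i | i + 1` separating `j` from `k`. -/
def bottleneck (d : ℕ → NNReal) (j k : ℕ) : NNReal :=
  (Finset.Ico (min j k) (max j k)).sup d

variable (d : ℕ → NNReal)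

lemma bottleneck_comm (j k : ℕ) : bottleneck d j k = bottleneck d k j := by
  simp [bottleneck, min_comm, max_comm]

lemma bottleneck_le_max (i j k : ℕ) :
    bottleneck d i k ≤ max (bottleneck d i j) (bottleneck d j k) := by
  unfold bottleneck
  refine (Finset.sup_mono ?_).trans Finset.sup_union.le
  intro x
  simp only [Finset.mem_union, Finset.mem_Ico]
  omega

lemma le_bottleneck {i j k : ℕ} (h : min j k ≤ i) (h' : i < max j k) :
    d i ≤ bottleneck d j k :=
  Finset.le_sup (f := d) (Finset.mem_Ico.2 ⟨h, h'⟩)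

lemma sum_Ico_succ_add_le_chainCost {m lo : ℕ} (hlo : lo ≤ m) (l : List ℕ)
    (hl : ∀ j ∈ l, lo ≤ j ∧ j ≤ m + 1) (hmem : ∀ j, lo ≤ j → j ≤ m + 1 → j ≠ m → j ∈ l) :
    ∑ i ∈ Finset.Ico lo (m + 1), d i + d m ≤ chainCost (bottleneck d) (m :: l ++ [m]) := by
  induction hlo using Nat.decreasingInduction generalizing l with
  | self =>
    refine le_trans ?_ (dist_add_dist_le_chainCost (tri_of_ultra (bottleneck_le_max d))
      (x := m + 1) m m l (hmem _ (by omega) le_rfl (by omega)))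
    simp only [Nat.Ico_succ_singleton, Finset.sum_singleton]
    exact add_le_add (le_bottleneck d (by omega) (by omega))
      (le_bottleneck d (by omega) (by omega))
  | of_succ k hk ih =>
    have h := chainCost_filter_ne_add_le (bottleneck_comm d) (bottleneck_le_max d)
      (x := k) (c := m) (δ := d k) m l (hmem k le_rfl (by omega) (by omega))
      (le_bottleneck d (by omega) (by omega)) (le_bottleneck d (by omega) (by omega))
      fun y hy hne => le_bottleneck d (by have := hl y hy; omega) (by have := hl y hy; omega)
    refine le_trans ?_ h
    rw [Finset.sum_eq_sum_Ico_succ_bot (by omega), add_assoc, add_comm (d k)]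
    gcongr
    refine ih _ (fun j hj => ?_) fun j h1 h2 h3 => ?_
    · simp only [List.mem_filter, decide_eq_true_eq] at hj
      have := hl j hj.1
      omega
    · simpa using ⟨hmem j (by omega) h2 h3, by omega⟩

lemma sum_range_add_le_chainCost {m n : ℕ} (hmn : m + 1 ≤ n) (l : List ℕ)
    (hl : ∀ j ∈ l, j ≤ n) (hmem : ∀ j ≤ n, j ≠ m → j ∈ l) :
    ∑ i ∈ Finset.range n, d i + d m ≤ chainCost (bottleneck d) (m :: l ++ [m]) := by
  induction n, hmn using Nat.le_induction generalizing l with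
  | base =>
    rw [Finset.range_eq_Ico]
    exact sum_Ico_succ_add_le_chainCost d (Nat.zero_le m) l (fun j hj => ⟨j.zero_le, hl j hj⟩)
      fun j _ => hmem j
  | succ n hn ih =>
    have h := chainCost_filter_ne_add_le (bottleneck_comm d) (bottleneck_le_max d)
      (x := n + 1) (c := m) (δ := d n) m l (hmem (n + 1) le_rfl (by omega))
      (le_bottleneck d (by omega) (by omega)) (le_bottleneck d (by omega) (by omega))
      fun y hy hne => le_bottleneck d (by have := hl y hy; omega) (by have := hl y hy; omega)
    refine le_trans ?_ h
    rw [Finset.sum_range_succ, add_right_comm]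
    gcongr
    refine ih _ (fun j hj => ?_) fun j h1 h2 => ?_
    · simp only [List.mem_filter, decide_eq_true_eq] at hj
      have := hl j hj.1
      omega
    · simpa using ⟨hmem j (by omega) h2, by omega⟩

end Bottleneck

section Distance

variable {V : Type*} {G : SimpleGraph V} (we : Sym2 V → NNReal)

lemma wdist_le_walkWeight {u v : V} (p : G.Walk u v) : wdist G we u v ≤ walkWeight we p :=
  csInf_le (OrderBot.bddBelow _) ⟨p, rfl⟩

lemma wdist_le_of_adj {u v : V} (h : G.Adj u v) : wdist G we u v ≤ we s(u, v) := by
  simpa [walkWeight] using wdist_le_walkWeight we h.toWalk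

lemma wdist_self (u : V) : wdist G we u u = 0 :=
  le_antisymm (by simpa [walkWeight] using wdist_le_walkWeight we (SimpleGraph.Walk.nil' (G := G) u))
    zero_le

lemma wdist_eq_iInf (u v : V) : wdist G we u v = ⨅ p : G.Walk u v, walkWeight we p := by
  simp only [wdist, iInf, Set.range, eq_comm]

lemma wdist_triangle (hG : G.Connected) (u v w : V) :
    wdist G we u w ≤ wdist G we u v + wdist G we v w := by
  have : Nonempty (G.Walk u v) := hG u v
  have : Nonempty (G.Walk v w) := hG v w
  rw [wdist_eq_iInf we u v, wdist_eq_iInf we v w]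
  refine NNReal.le_iInf_add_iInf fun p q => (wdist_le_walkWeight we (p.append q)).trans_eq ?_
  simp [walkWeight]

lemma wdist_comm (u v : V) : wdist G we u v = wdist G we v u := by
  unfold wdist
  congr 1
  ext x
  constructor <;> rintro ⟨p, rfl⟩ <;> exact ⟨p.reverse, by simp [walkWeight]⟩

lemma setDist_le_wdist {A : Set V} {u : V} (hu : u ∈ A) (v : V) :
    setDist G we A v ≤ wdist G we u v :=
  csInf_le (OrderBot.bddBelow _) ⟨u, hu, rfl⟩

end Distance

section ClosedTour

variable {V : Type*} [Finite V] {G : SimpleGraph V} (we : Sym2 V → NNReal)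

open Classical in
lemma subgraphCost_eq_sum (H : G.Subgraph) :
    subgraphCost we H = ∑ e ∈ H.edgeSet.toFinite.toFinset, we e :=
  finsum_mem_eq_finite_toFinset_sum we _

open Classical in
/-- A closed tour that does not yet visit all vertices of `H` can be extended by a detour along
an edge of `H` leaving it, so that it pays for each edge of `H` at most twice. -/
lemma exists_closed_tour (H : G.Subgraph) (hH : H.Connected) {c : V} (hc : c ∈ H.verts) :
    ∃ l : List V, H.verts ⊆ {v | v ∈ c :: l} ∧
      chainCost (wdist G we) (c :: l ++ [c]) ≤ 2 * subgraphCost we H := by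
  by_contra! hcon
  have grow : ∀ n : ℕ, ∃ (l : List V) (F : Finset (Sym2 V)), F.card = n ∧
      (F : Set (Sym2 V)) ⊆ H.edgeSet ∧ (∀ e ∈ F, ∀ v ∈ e, v ∈ c :: l) ∧
      chainCost (wdist G we) (c :: l ++ [c]) ≤ 2 * ∑ e ∈ F, we e := by
    intro n
    induction n with
    | zero => exact ⟨[], ∅, by simp [wdist_self]⟩
    | succ n ih =>
      obtain ⟨l, F, hF, hFH, hFl, hcost⟩ := ih
      have hle : chainCost (wdist G we) (c :: l ++ [c]) ≤ 2 * subgraphCost we H := by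
        refine hcost.trans ?_
        rw [subgraphCost_eq_sum]
        gcongr
        intro e he
        simpa using hFH he
      obtain ⟨v, hv, hvl⟩ : ∃ v ∈ H.verts, v ∉ c :: l := by
        by_contra! h
        exact (hcon l h).not_ge hle
      obtain ⟨p⟩ := hH.coe ⟨c, hc⟩ ⟨v, hv⟩
      obtain ⟨e, -, he1, he2⟩ := p.exists_boundary_dart {w | (w : V) ∈ c :: l} (by simp) hvl
      obtain ⟨⟨⟨a, ha⟩, ⟨b, hb⟩⟩, hab⟩ := e
      replace hab : H.Adj a b := hab
      simp only [Set.mem_ofPred_eq] at he1 he2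
      obtain ⟨l', hl', hl'cost⟩ : ∃ l' : List V, (∀ x, x ∈ c :: l' ↔ x ∈ c :: l ∨ x = b) ∧
          chainCost (wdist G we) (c :: l' ++ [c]) = chainCost (wdist G we) (c :: l ++ [c]) +
            (wdist G we a b + wdist G we b a) := by
        by_cases hac : a = c
        · subst hac
          refine ⟨b :: a :: l, fun x => ?_, ?_⟩
          · simp only [List.mem_cons]; tauto
          · exact chainCost_insert_detour [] (l ++ [a]) a b
        · obtain ⟨A, B, rfl⟩ := List.append_of_mem (by simpa [hac] using he1 : a ∈ l)
          refine ⟨A ++ a :: b :: a :: B, fun x => ?_, ?_⟩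
          · simp only [List.mem_cons, List.mem_append]; tauto
          · simpa using chainCost_insert_detour (D := wdist G we) (c :: A) (B ++ [c]) a b
      have hnot : s(a, b) ∉ F := fun h => he2 (hFl _ h b (by simp))
      refine ⟨l', insert s(a, b) F, by simp [hnot, hF], ?_, ?_, ?_⟩
      · rw [Finset.coe_insert]
        exact Set.insert_subset hab hFH
      · intro e he x hx
        rw [hl']
        rcases Finset.mem_insert.1 he with rfl | he
        · rcases Sym2.mem_iff.1 hx with rfl | rfl
          · exact Or.inl he1
          · exact Or.inr rfl
        · exact Or.inl (hFl e he x hx)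
      · rw [hl'cost, Finset.sum_insert hnot, wdist_comm we b a, mul_add, add_comm (2 * _),
          two_mul (we _)]
        have := wdist_le_of_adj we hab.adj_sub
        gcongr
  obtain ⟨l, F, hF, hFH, -⟩ := grow (H.edgeSet.toFinite.toFinset.card + 1)
  have : F ⊆ H.edgeSet.toFinite.toFinset := fun e he => by simpa using hFH he
  have := Finset.card_le_card this
  omega

end ClosedTour

lemma card_coe_edgeSet {V : Type*} {G : SimpleGraph V} (H : G.Subgraph) :
    Nat.card H.coe.edgeSet = H.edgeSet.ncard := by
  rw [← H.image_coe_edgeSet_coe, Set.ncard_image_of_injective _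
    (Sym2.map.injective Subtype.val_injective), Nat.card_coe_set_eq]

section Step

variable {V : Type*} [Finite V] {G : SimpleGraph V} (we : Sym2 V → NNReal)

open Classical in
lemma subgraphCost_sup_toSubgraph_le (T : G.Subgraph) {u v : V} (p : G.Walk u v) :
    subgraphCost we (T ⊔ p.toSubgraph) ≤ subgraphCost we T + walkWeight we p := by
  have hp : ∑ e ∈ p.edges.toFinset, we e ≤ walkWeight we p := by
    unfold walkWeight
    induction p.edges with
    | nil => simp
    | cons e l ih =>
      rw [List.toFinset_cons, List.map_cons, List.sum_cons]
      refine le_trans ?_ (add_le_add_right ih _)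
      by_cases h : e ∈ l.toFinset
      · rw [Finset.insert_eq_of_mem h]
        exact le_add_of_nonneg_left zero_le
      · rw [Finset.sum_insert h]
  rw [subgraphCost_eq_sum, subgraphCost_eq_sum]
  refine le_trans ?_ (add_le_add_right hp _)
  rw [← Finset.sum_union_inter]
  refine le_add_of_le_of_nonneg (Finset.sum_le_sum_of_subset fun e he => ?_) zero_le
  simpa [SimpleGraph.Walk.edgeSet] using he

lemma isTree_sup_toSubgraph {T : G.Subgraph} (hT : T.coe.IsTree) {u v : V} (hu : u ∈ T.verts)
    (p : G.Walk u v) (hp : p.IsPath) (hz : ∀ z ∈ p.support, z ≠ u → z ∉ T.verts) :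
    (T ⊔ p.toSubgraph).coe.IsTree := by
  classical
  have hconn : (T ⊔ p.toSubgraph).Connected :=
    SimpleGraph.Subgraph.connected_sup ⟨hT.connected.preconnected⟩
      p.toSubgraph_connected.preconnected ⟨u, hu, by simp⟩
  rw [SimpleGraph.isTree_iff_connected_and_card] at hT ⊢
  refine ⟨hconn.coe, le_antisymm ?_ hconn.coe.card_vert_le_card_edgeSet_add_one⟩
  have hTcard := hT.2
  rw [card_coe_edgeSet, Nat.card_coe_set_eq] at hTcard ⊢
  have hE : (T ⊔ p.toSubgraph).edgeSet.ncard ≤ T.edgeSet.ncard + p.length := by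
    rw [SimpleGraph.Subgraph.edgeSet_sup]
    refine (Set.ncard_union_le _ _).trans ?_
    gcongr
    have : p.toSubgraph.edgeSet = (p.edges.toFinset : Set (Sym2 V)) := by
      ext e; simp
    rw [this, Set.ncard_coe_finset, ← p.length_edges]
    exact List.toFinset_card_le _
  have hV : T.verts.ncard + p.length ≤ (T ⊔ p.toSubgraph).verts.ncard := by
    have hnodup := hp.support_nodup
    rw [← p.cons_tail_support] at hnodup
    have htail : (p.support.tail.toFinset : Set V).ncard = p.length := by
      rw [Set.ncard_coe_finset, List.toFinset_card_of_nodup (List.nodup_cons.1 hnodup).2]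
      simp
    rw [← htail, ← Set.ncard_union_eq]
    · refine Set.ncard_le_ncard ?_
      rintro z (hzT | hzp)
      · exact Or.inl hzT
      · exact Or.inr (p.mem_verts_toSubgraph.2 (List.mem_of_mem_tail (by simpa using hzp)))
    · refine Set.disjoint_right.2 fun z hzp => ?_
      replace hzp : z ∈ p.support.tail := by simpa using hzp
      refine hz z (List.mem_of_mem_tail hzp) ?_
      rintro rfl
      exact (List.nodup_cons.1 hnodup).1 hzp
  omega

lemma ChinsStep.exists_cost {S : Set V} {T T' : G.Subgraph} (h : ChinsStep G we S T T') :
    ∃ δ : NNReal, (∃ x ∈ S, x ∉ T.verts ∧ x ∈ T'.verts) ∧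
      (∀ y ∈ S, y ∉ T.verts → δ ≤ setDist G we T.verts y) ∧
      subgraphCost we T' ≤ subgraphCost we T + δ ∧ T.verts ⊆ T'.verts ∧
      (T.coe.IsTree → T'.coe.IsTree) := by
  obtain ⟨x, hxS, hxT, hmin, u, hu, p, hp, hw, hz, rfl⟩ := h
  refine ⟨setDist G we T.verts x, ⟨x, hxS, hxT, Or.inr (by simp)⟩, hmin, ?_,
    Set.subset_union_left, fun hT => isTree_sup_toSubgraph hT hu p hp hz⟩
  rw [← hw]
  exact subgraphCost_sup_toSubgraph_le we T p

end Step

section Greedy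

variable {V : Type*} [Finite V] {G : SimpleGraph V} (we : Sym2 V → NNReal)

open Classical in
/-- If the sets `A 0, …, A n` grow in such a way that a new terminal enters at each step and each
`d i` bounds from below the distance from `A i` to the terminals outside it, then the `d i`,
with any one of them counted twice, cost at most twice as much as a connected subgraph
containing the terminals. -/
lemma sum_add_le_two_mul_subgraphCost (hG : G.Connected) {S : Set V} {n : ℕ} {A : ℕ → Set V}
    (d : ℕ → NNReal) (hA : ∀ i < n, A i ⊆ A (i + 1)) (hS : S ⊆ A n)
    (hnew : ∀ i ≤ n, ∃ x ∈ S, x ∈ A i ∧ ∀ j < i, x ∉ A j)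
    (hd : ∀ i < n, ∀ y ∈ S, y ∉ A i → d i ≤ setDist G we (A i) y)
    {H : G.Subgraph} (hH : H.Connected) (hSH : S ⊆ H.verts) {m : ℕ} (hm : m < n) :
    ∑ i ∈ Finset.range n, d i + d m ≤ 2 * subgraphCost we H := by
  have hmono : ∀ i j, i ≤ j → j ≤ n → A i ⊆ A j := by
    intro i j hij
    induction j, hij using Nat.le_induction with
    | base => exact fun _ => subset_rfl
    | succ j _ ih => exact fun hj => (ih (by omega)).trans (hA j (by omega))
  obtain ⟨idx, idx_le, idx_mem, not_mem⟩ : ∃ idx : V → ℕ, (∀ v i, v ∈ A i → idx v ≤ i) ∧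
      (∀ v ∈ S, v ∈ A (idx v)) ∧ ∀ v i, i < idx v → v ∉ A i :=
    ⟨fun v => sInf {i | v ∈ A i}, fun _ _ h => Nat.sInf_le h,
      fun v h => Nat.sInf_mem (s := {i | v ∈ A i}) ⟨n, hS h⟩,
      fun v _ h => Nat.notMem_of_lt_sInf (s := {i | v ∈ A i}) h⟩
  have idx_surj : ∀ i ≤ n, ∃ x ∈ S, idx x = i := by
    intro i hi
    obtain ⟨x, hxS, hxi, hx⟩ := hnew i hi
    exact ⟨x, hxS, le_antisymm (idx_le _ _ hxi) (not_lt.1 fun h => hx _ h (idx_mem _ hxS))⟩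
  have hle : ∀ a ∈ S, ∀ b ∈ S, idx a ≤ idx b →
      bottleneck d (idx a) (idx b) ≤ wdist G we a b := by
    intro a ha b hb hab
    refine Finset.sup_le fun i hi => ?_
    rw [min_eq_left hab, max_eq_right hab, Finset.mem_Ico] at hi
    have hin : i < n := hi.2.trans_le (idx_le _ _ (hS hb))
    exact (hd i hin b hb (not_mem _ _ hi.2)).trans
      (setDist_le_wdist we (hmono _ _ hi.1 hin.le (idx_mem _ ha)) b)
  have hle' : ∀ a ∈ S, ∀ b ∈ S, bottleneck d (idx a) (idx b) ≤ wdist G we a b := by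
    intro a ha b hb
    rcases le_total (idx a) (idx b) with h | h
    · exact hle a ha b hb h
    · rw [bottleneck_comm, wdist_comm]
      exact hle b hb a ha h
  obtain ⟨c, hcS, hcm⟩ := idx_surj m hm.le
  obtain ⟨l, hl, hcost⟩ := exists_closed_tour we H hH (hSH hcS)
  refine le_trans ?_ hcost
  refine le_trans ?_ (chainCost_filter_le (wdist_triangle we hG) (· ∈ S) c c l)
  refine le_trans ?_ (chainCost_map_le idx _ fun a ha b hb => hle' a ?_ b ?_)
  · rw [List.map_append, List.map_cons, List.map_singleton, hcm]
    refine sum_range_add_le_chainCost d hm _ (fun j hj => ?_) fun j hj hjm => ?_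
    · simp only [List.mem_map, List.mem_filter, decide_eq_true_eq] at hj
      obtain ⟨v, ⟨-, hv⟩, rfl⟩ := hj
      exact idx_le _ _ (hS hv)
    · obtain ⟨x, hxS, rfl⟩ := idx_surj j hj
      have hxc : x ≠ c := by rintro rfl; exact hjm hcm
      have hxl : x ∈ c :: l := hl (hSH hxS)
      simp only [List.mem_map, List.mem_filter, decide_eq_true_eq]
      exact ⟨x, ⟨by simpa [hxc] using hxl, hxS⟩, rfl⟩
  · simp only [List.cons_append, List.mem_cons, List.mem_append, List.mem_filter,
      decide_eq_true_eq, List.not_mem_nil, or_false] at ha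
    rcases ha with rfl | ⟨-, ha⟩ | rfl <;> assumption
  · simp only [List.cons_append, List.mem_cons, List.mem_append, List.mem_filter,
      decide_eq_true_eq, List.not_mem_nil, or_false] at hb
    rcases hb with rfl | ⟨-, hb⟩ | rfl <;> assumption

end Greedy

lemma sum_le_of_sum_add_le {n : ℕ} {d : ℕ → ℝ} {C : ℝ}
    (h : ∀ m < n, ∑ i ∈ Finset.range n, d i + d m ≤ C) :
    ∑ i ∈ Finset.range n, d i ≤ (1 - 1 / ((n + 1 : ℕ) : ℝ)) * C := by
  have hsum := Finset.sum_le_sum fun m hm => h m (Finset.mem_range.1 hm)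
  simp only [Finset.sum_add_distrib, Finset.sum_const, Finset.card_range, nsmul_eq_mul] at hsum
  have hn : (0 : ℝ) < ((n + 1 : ℕ) : ℝ) := by positivity
  have : (1 - 1 / ((n + 1 : ℕ) : ℝ)) * C = n * C / ((n + 1 : ℕ) : ℝ) := by
    field_simp
    push_cast
    ring
  rw [this, le_div_iff₀ hn]
  push_cast
  linarith

/-- CHINS worst-case bound: starting from a single terminal and repeatedly
connecting the nearest not-yet-included terminal to the current partial tree via
a shortest path, the procedure produces a tree spanning all `κ` terminals whose
total cost is at most `2 · (1 - 1/κ)` times the cost of an optimal Steiner tree;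
in particular at most twice the optimum. -/
theorem chins_bound {V : Type*} [Fintype V] (G : SimpleGraph V)
    (we : Sym2 V → NNReal) (hG : G.Connected)
    (κ : ℕ) (hκ : 1 ≤ κ) (t : Fin κ → V)
    (T : ℕ → G.Subgraph)
    (h0 : T 0 = SimpleGraph.singletonSubgraph G (t ⟨0, hκ⟩))
    (hstep : ∀ i < κ - 1, ChinsStep G we (Set.range t) (T i) (T (i + 1)))
    (Topt : G.Subgraph) (hopt : IsSteinerTree G (Set.range t) Topt)
    (hoptmin : ∀ H, IsSteinerTree G (Set.range t) H →
      subgraphCost we Topt ≤ subgraphCost we H) :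
    Set.range t ⊆ (T (κ - 1)).verts ∧ ((T (κ - 1)).coe).IsTree ∧
      (subgraphCost we (T (κ - 1)) : ℝ) ≤
        2 * (1 - 1 / (κ : ℝ)) * (subgraphCost we Topt : ℝ) ∧
      (subgraphCost we (T (κ - 1)) : ℝ) ≤ 2 * (subgraphCost we Topt : ℝ) := by
  obtain ⟨n, rfl⟩ : ∃ n, κ = n + 1 := ⟨κ - 1, by omega⟩
  rw [Nat.add_sub_cancel] at *
  set S := Set.range t with hS
  choose! d hnew hd hcost hmono htree using fun i hi => (hstep i hi).exists_cost
  have hmono' : ∀ i j, i ≤ j → j ≤ n → (T i).verts ⊆ (T j).verts := by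
    intro i j hij
    induction j, hij using Nat.le_induction with
    | base => exact fun _ => subset_rfl
    | succ j _ ih => exact fun hj => (ih (by omega)).trans (hmono j (by omega))
  have hnew' : ∀ i ≤ n, ∃ x ∈ S, x ∈ (T i).verts ∧ ∀ j < i, x ∉ (T j).verts := by
    rintro (_ | i) hi
    · exact ⟨t ⟨0, hκ⟩, ⟨_, rfl⟩, by simp [h0], by simp⟩
    · obtain ⟨x, hxS, hx, hx'⟩ := hnew i (by omega)
      exact ⟨x, hxS, hx', fun j hj h => hx (hmono' j i (by omega) (by omega) h)⟩
  have hSn : S ⊆ (T n).verts := by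
    have : Nonempty V := ⟨t ⟨0, hκ⟩⟩
    choose! x hxS hx hx' using hnew'
    have hinj : Function.Injective fun i : Fin (n + 1) => x i := by
      intro i j hij
      by_contra hne
      wlog hlt : i < j generalizing i j
      · exact this hij.symm (Ne.symm hne) (lt_of_le_of_ne (not_lt.1 hlt) (Ne.symm hne))
      · refine hx' j (by omega) i hlt ?_
        rw [← show x i = x j from hij]
        exact hx i (by omega)
    have hsub : Set.range (fun i : Fin (n + 1) => x i) ⊆ S := by
      rintro _ ⟨i, rfl⟩
      exact hxS i (by omega)
    have hcard : S.ncard ≤ (Set.range fun i : Fin (n + 1) => x i).ncard := by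
      rw [Set.ncard_range_of_injective hinj, hS, ← Set.image_univ]
      exact (Set.ncard_image_le Set.finite_univ).trans (Set.ncard_univ _).le
    rw [← Set.eq_of_subset_of_ncard_le hsub hcard (Set.toFinite S)]
    rintro _ ⟨i, rfl⟩
    exact hmono' i n (by omega) le_rfl (hx i (by omega))
  have htreeAll : ∀ i ≤ n, (T i).coe.IsTree := by
    intro i
    induction i with
    | zero =>
      intro _
      rw [h0]
      exact ⟨SimpleGraph.Subgraph.singletonSubgraph_connected.coe,
        SimpleGraph.IsAcyclic.of_subsingleton⟩
    | succ i ih => exact fun hi => htree i (by omega) (ih (by omega))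
  have hcostAll : ∀ i ≤ n, subgraphCost we (T i) ≤ ∑ j ∈ Finset.range i, d j := by
    intro i
    induction i with
    | zero =>
      intro _
      simp [h0, subgraphCost]
    | succ i ih =>
      intro hi
      rw [Finset.sum_range_succ]
      exact (hcost i (by omega)).trans (by gcongr; exact ih (by omega))
  have hbound : (subgraphCost we (T n) : ℝ) ≤
      2 * (1 - 1 / ((n + 1 : ℕ) : ℝ)) * (subgraphCost we Topt : ℝ) := by
    have hsum := sum_le_of_sum_add_le (n := n) (d := fun i => (d i : ℝ))
      (C := 2 * (subgraphCost we Topt : ℝ)) fun m hm => by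
        exact_mod_cast sum_add_le_two_mul_subgraphCost we hG d hmono hSn hnew' hd
          ⟨hopt.2.connected⟩ hopt.1 hm
    refine le_trans (by exact_mod_cast hcostAll n le_rfl) (hsum.trans_eq (by ring))
  refine ⟨hSn, htreeAll n le_rfl, hbound, hbound.trans ?_⟩
  gcongr
  have : (0 : ℝ) ≤ 1 / ((n + 1 : ℕ) : ℝ) := by positivity
  linarith
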